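/- Assume the Gaussian Talenti inequality: (-f*)'(s) I(s) ≤ (d/ds) ∫_{{|f| > f*(s)}} |∇f| dγₙ for every Lipschitz f and a.e. s ∈ (0,1). Then for every Lipschitz f and every t ∈ (0,1), f**(t) - f*(t) ≤ (t/I(t)) |∇f|**(t). -/

import Mathlib

open MeasureTheory Real

/-- The standard one-dimensional Gaussian density `φ(x) = (2π)^{-1/2} e^{-x²/2}`. -/
noncomputable def gaussPdf (x : ℝ) : ℝ := (2 * Real.pi) ^ (-(1:ℝ)/2) * Real.exp (-x^2 / 2)

/-- The standard Gaussian cumulative distribution function `Φ(r) = ∫_{-∞}^r φ(t) dt`. -/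
noncomputable def gaussCdf (r : ℝ) : ℝ := ∫ t in Set.Iic r, gaussPdf t

/-- The inverse of `Φ`. -/
noncomputable def gaussCdfInv : ℝ → ℝ := Function.invFun gaussCdf

/-- The Gaussian isoperimetric function `I(t) = φ(Φ⁻¹(t))` on `(0,1)`, with `I(0)=I(1)=0`. -/
noncomputable def Igauss (t : ℝ) : ℝ :=
  if t = 0 ∨ t = 1 then 0 else gaussPdf (gaussCdfInv t)

open scoped ENNReal

/-- The standard Gaussian measure `γₙ` on `ℝⁿ`. -/
noncomputable def gaussMeasure (n : ℕ) : Measure (Fin n → ℝ) :=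
  Measure.pi fun _ => ProbabilityTheory.gaussianReal 0 1

/-- The Gaussian distribution function `λ_f(t) = γₙ({|f| > t})`. -/
noncomputable def distFun (n : ℕ) (f : (Fin n → ℝ) → ℝ) (t : ℝ) : ℝ :=
  (gaussMeasure n {x | t < |f x|}).toReal

/-- The decreasing rearrangement of `f` with respect to `γₙ`:
`f*(s) = inf {t ≥ 0 : λ_f(t) ≤ s}`. -/
noncomputable def rearr (n : ℕ) (f : (Fin n → ℝ) → ℝ) (s : ℝ) : ℝ :=
  sInf {t : ℝ | 0 ≤ t ∧ distFun n f t ≤ s}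

/-- The maximal function of the rearrangement, `f**(t) = (1/t) ∫₀ᵗ f*(s) ds`. -/
noncomputable def rearr2 (n : ℕ) (f : (Fin n → ℝ) → ℝ) (t : ℝ) : ℝ :=
  (1/t) * ∫ s in (0:ℝ)..t, rearr n f s

/-- The modulus of the gradient, `|∇f|(x) = ‖Df(x)‖`. -/
noncomputable def gradNorm (n : ℕ) (f : (Fin n → ℝ) → ℝ) (x : Fin n → ℝ) : ℝ :=
  ‖fderiv ℝ f x‖

/-- The Gaussian symmetrization `f°(x) = f*(Φ(x₁))`. -/
noncomputable def gaussSymm (n : ℕ) [NeZero n] (f : (Fin n → ℝ) → ℝ)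
    (x : Fin n → ℝ) : ℝ :=
  rearr n f (gaussCdf (x 0))


theorem aux_isGaussian (n : ℕ) : ProbabilityTheory.IsGaussian (gaussMeasure n) := by
  have h := ProbabilityTheory.map_pi_eq_stdGaussian (ι := Fin n)
  have h2 : gaussMeasure n = (ProbabilityTheory.stdGaussian (EuclideanSpace ℝ (Fin n))).map
      (EuclideanSpace.equiv (Fin n) ℝ) := by
    rw [← h, Measure.map_map (by fun_prop) (by fun_prop)]
    symm
    exact Measure.map_id
  rw [h2]
  infer_instance

theorem aux_mean (n : ℕ) (L : StrongDual ℝ (Fin n → ℝ)) : ∫ x, L x ∂(gaussMeasure n) = 0 := by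
  have h := ProbabilityTheory.map_pi_eq_stdGaussian (ι := Fin n)
  have h2 : gaussMeasure n = (ProbabilityTheory.stdGaussian (EuclideanSpace ℝ (Fin n))).map
      (EuclideanSpace.equiv (Fin n) ℝ) := by
    rw [← h, Measure.map_map (by fun_prop) (by fun_prop)]
    symm
    exact Measure.map_id
  rw [h2, integral_map (by fun_prop) (by fun_prop)]
  exact ProbabilityTheory.integral_strongDual_stdGaussian
    (L ∘L (EuclideanSpace.equiv (Fin n) ℝ : EuclideanSpace ℝ (Fin n) →L[ℝ] (Fin n → ℝ)))

theorem aux_rot (n : ℕ) (θ : ℝ) : ((gaussMeasure n).prod (gaussMeasure n)).map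
    (ContinuousLinearMap.rotation θ) = (gaussMeasure n).prod (gaussMeasure n) := by
  have := aux_isGaussian n
  exact ProbabilityTheory.IsGaussian.map_rotation_eq_self_of_forall_strongDual_eq_zero (aux_mean n) θ

theorem aux_path {n : ℕ} {h : (Fin n → ℝ) → ℝ} {K : NNReal} (hK : LipschitzWith K h)
    {a b : ℝ} (hab : a ≤ b) (x y : Fin n → ℝ) (hx : h x ≤ a) (hy : b ≤ h y) :
    ENNReal.ofReal (b - a) ≤ ∫⁻ θ in Set.Ioc (0:ℝ) (π/2),
      {z | a < h z ∧ h z < b}.indicator (fun _ => (1:ℝ≥0∞))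
        (Real.cos θ • x + Real.sin θ • y) * (K * ‖- Real.sin θ • x + Real.cos θ • y‖ₑ) := by
  set c : ℝ → (Fin n → ℝ) := fun θ => Real.cos θ • x + Real.sin θ • y with hc
  have hcd : ∀ θ, HasDerivAt c (- Real.sin θ • x + Real.cos θ • y) θ := fun θ =>
    ((Real.hasDerivAt_cos θ).smul_const x).add ((Real.hasDerivAt_sin θ).smul_const y)
  set q : ℝ → ℝ := fun θ => max a (min (h (c θ)) b) with hq
  have hqc : ∀ θ θ', |q θ - q θ'| ≤ K * ‖c θ - c θ'‖ := by
    intro θ θ'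
    have h1 := hK.dist_le_mul (c θ) (c θ')
    rw [Real.dist_eq, dist_eq_norm] at h1
    refine le_trans ?_ h1
    simp only [hq]
    refine (abs_max_sub_max_le_max _ _ _ _).trans ?_
    simp only [sub_self, abs_zero]
    refine max_le (abs_nonneg _) ?_
    refine (abs_min_sub_min_le_max _ _ _ _).trans ?_
    simp
  have hcL : ∀ θ θ', ‖c θ - c θ'‖ ≤ (‖x‖ + ‖y‖) * |θ - θ'| := by
    intro θ θ'
    have h1 := Convex.norm_image_sub_le_of_norm_hasDerivWithin_le (f := c) (s := Set.univ)
      (C := ‖x‖ + ‖y‖) (x := θ') (y := θ) (fun z _ => (hcd z).hasDerivWithinAt) (fun z _ => by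
        refine (norm_add_le _ _).trans ?_
        rw [norm_smul, norm_smul]
        have h1 : ‖-Real.sin z‖ ≤ 1 := by rw [norm_neg]; exact Real.abs_sin_le_one z
        have h2 : ‖Real.cos z‖ ≤ 1 := Real.abs_cos_le_one z
        nlinarith [norm_nonneg x, norm_nonneg y]) convex_univ trivial trivial
    simpa using h1
  have hqL : LipschitzWith (K * (‖x‖₊ + ‖y‖₊)) q := by
    refine LipschitzWith.of_dist_le_mul fun θ θ' => ?_
    rw [Real.dist_eq, Real.dist_eq]
    push_cast
    calc _ ≤ _ := hqc θ θ'
      _ ≤ K * ((‖x‖ + ‖y‖) * |θ - θ'|) := by gcongr; exact hcL θ θ'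
      _ = _ := by ring
  have hFTC := (hqL.lipschitzOnWith (s := Set.uIcc 0 (π/2))).absolutelyContinuousOnInterval.integral_deriv_eq_sub
  have hq0 : q 0 = a := by simp [hq, hc, hx]
  have hq1 : q (π/2) = b := by simp [hq, hc, hy, hab]
  have hba : ENNReal.ofReal (b - a) ≤ ∫⁻ θ in Set.Ioc (0:ℝ) (π/2), ‖deriv q θ‖ₑ := by
    rw [← hq0, ← hq1, ← hFTC, intervalIntegral.integral_of_le (by positivity)]
    refine le_trans ?_ (enorm_integral_le_lintegral_enorm _)
    rw [← ofReal_norm]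
    exact ENNReal.ofReal_le_ofReal (le_abs_self _)
  refine hba.trans (lintegral_mono fun θ => ?_)
  have hder : ‖deriv q θ‖ₑ ≤ K * ‖- Real.sin θ • x + Real.cos θ • y‖ₑ := by
    by_cases hd : DifferentiableAt ℝ q θ
    · have h1 := (hasDerivAt_iff_tendsto_slope.1 hd.hasDerivAt).norm
      have h2 := ((hasDerivAt_iff_tendsto_slope.1 (hcd θ)).norm).const_mul (K:ℝ)
      have h3 : ‖deriv q θ‖ ≤ K * ‖- Real.sin θ • x + Real.cos θ • y‖ := by
        refine le_of_tendsto_of_tendsto' h1 h2 fun z => ?_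
        rw [slope_def_module, slope_def_module, norm_smul, norm_smul]
        have := hqc z θ
        rw [Real.norm_eq_abs (q z - q θ)]
        calc _ ≤ ‖(z - θ)⁻¹‖ * (K * ‖c z - c θ‖) := by gcongr
          _ = _ := by ring
      rw [← ofReal_norm, ← ofReal_norm (- Real.sin θ • x + Real.cos θ • y)]
      refine (ENNReal.ofReal_le_ofReal h3).trans ?_
      rw [ENNReal.ofReal_mul (by positivity), ENNReal.ofReal_coe_nnreal]
    · rw [deriv_zero_of_not_differentiableAt hd]; simp
  by_cases hin : a < h (c θ) ∧ h (c θ) < b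
  · rw [Set.indicator_of_mem (by exact hin), one_mul]; exact hder
  · have h0 : deriv q θ = 0 := by
      by_cases h1 : a < h (c θ)
      · have h2 : b ≤ h (c θ) := by by_contra h3; exact hin ⟨h1, not_le.1 h3⟩
        refine IsLocalMax.deriv_eq_zero (Filter.Eventually.of_forall fun z => ?_)
        simp [hq, h2, hab]
      · refine IsLocalMin.deriv_eq_zero (Filter.Eventually.of_forall fun z => ?_)
        simp [hq, not_lt.1 h1]
    simp [h0]

theorem aux_iso {n : ℕ} {h : (Fin n → ℝ) → ℝ} {K : NNReal} (hK : LipschitzWith K h) :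
    ∃ C : ℝ, 0 ≤ C ∧ ∀ a b : ℝ, a ≤ b →
      (b - a) * ((gaussMeasure n).real {x | h x ≤ a} * (gaussMeasure n).real {x | b ≤ h x}) ≤
        C * (gaussMeasure n).real {x | a < h x ∧ h x < b} := by
  have := aux_isGaussian n
  set μ := gaussMeasure n with hμ
  have hM : ∫⁻ y, ‖y‖ₑ ∂μ ≠ ∞ := by
    have := (ProbabilityTheory.IsGaussian.integrable_id (μ := μ)).2
    exact this.ne
  set M := ∫⁻ y, ‖y‖ₑ ∂μ with hMd
  refine ⟨(ENNReal.ofReal (π/2) * (K * M)).toReal, ENNReal.toReal_nonneg, fun a b hab => ?_⟩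
  have hm := hK.continuous.measurable
  have mA : MeasurableSet {x | h x ≤ a} := measurableSet_le hm measurable_const
  have mB : MeasurableSet {x | b ≤ h x} := measurableSet_le measurable_const hm
  have mC : MeasurableSet {x | a < h x ∧ h x < b} :=
    (measurableSet_lt measurable_const hm).inter (measurableSet_lt hm measurable_const)
  have key : ENNReal.ofReal (b - a) * (μ {x | h x ≤ a} * μ {x | b ≤ h x}) ≤
      ENNReal.ofReal (π/2) * (K * M) * μ {x | a < h x ∧ h x < b} := by
    set F : (Fin n → ℝ) × (Fin n → ℝ) → ℝ≥0∞ := fun p =>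
      {z | a < h z ∧ h z < b}.indicator (fun _ => (1:ℝ≥0∞)) p.1 * (K * ‖p.2‖ₑ) with hF
    have mF : Measurable F := by
      refine ((measurable_const.indicator mC).comp measurable_fst).mul ?_
      fun_prop
    have hrot : Measurable fun p : ((Fin n → ℝ) × (Fin n → ℝ)) × ℝ =>
        ContinuousLinearMap.rotation p.2 p.1 := by
      simp only [ContinuousLinearMap.rotation_apply]
      fun_prop
    calc _ = ENNReal.ofReal (b - a) * (μ.prod μ) ({x | h x ≤ a} ×ˢ {x | b ≤ h x}) := by
          rw [Measure.prod_prod]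
      _ = ∫⁻ p in {x | h x ≤ a} ×ˢ {x | b ≤ h x}, ENNReal.ofReal (b - a) ∂(μ.prod μ) := by simp
      _ ≤ ∫⁻ p in {x | h x ≤ a} ×ˢ {x | b ≤ h x}, (∫⁻ θ in Set.Ioc (0:ℝ) (π/2),
            F (ContinuousLinearMap.rotation θ p)) ∂(μ.prod μ) := by
          refine setLIntegral_mono' (mA.prod mB) fun p hp => ?_
          have := aux_path hK hab p.1 p.2 hp.1 hp.2
          simpa only [hF, ContinuousLinearMap.rotation_apply] using this
      _ ≤ ∫⁻ p, (∫⁻ θ in Set.Ioc (0:ℝ) (π/2),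
            F (ContinuousLinearMap.rotation θ p)) ∂(μ.prod μ) := setLIntegral_le_lintegral _ _
      _ = ∫⁻ θ in Set.Ioc (0:ℝ) (π/2), ∫⁻ p, F (ContinuousLinearMap.rotation θ p) ∂(μ.prod μ) :=
          lintegral_lintegral_swap (mF.comp hrot).aemeasurable
      _ = ∫⁻ θ in Set.Ioc (0:ℝ) (π/2), (K * M) * μ {x | a < h x ∧ h x < b} := by
          refine lintegral_congr fun θ => ?_
          rw [← lintegral_map mF (ContinuousLinearMap.rotation θ).continuous.measurable, aux_rot]
          have e : ∫⁻ p, F p ∂(μ.prod μ) =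
              (∫⁻ z, {z | a < h z ∧ h z < b}.indicator (fun _ => (1:ℝ≥0∞)) z ∂μ) *
                ∫⁻ z, K * ‖z‖ₑ ∂μ :=
            lintegral_prod_mul (f := {z | a < h z ∧ h z < b}.indicator (fun _ => (1:ℝ≥0∞)))
              (g := fun z : Fin n → ℝ => (K:ℝ≥0∞) * ‖z‖ₑ)
              (measurable_const.indicator mC).aemeasurable (by fun_prop)
          rw [e, lintegral_const_mul _ (by fun_prop), lintegral_indicator_const mC, one_mul,
            mul_comm]
      _ = _ := by
          rw [lintegral_const]; simp; ring
  have := ENNReal.toReal_mono (by finiteness) key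
  rwa [ENNReal.toReal_mul, ENNReal.toReal_mul, ENNReal.toReal_mul,
    ENNReal.toReal_ofReal (sub_nonneg.2 hab)] at this

theorem aux_pdf_pos (x : ℝ) : 0 < gaussPdf x := by unfold gaussPdf; positivity

theorem aux_pdf_eq (x : ℝ) : gaussPdf x = ProbabilityTheory.gaussianPDFReal 0 1 x := by
  unfold gaussPdf ProbabilityTheory.gaussianPDFReal
  simp only [NNReal.coe_one, mul_one, sub_zero]
  congr 1
  rw [Real.sqrt_eq_rpow, ← Real.rpow_neg (by positivity)]
  norm_num

theorem aux_pdf_int : Integrable gaussPdf := by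
  have : gaussPdf = ProbabilityTheory.gaussianPDFReal 0 1 := funext aux_pdf_eq
  rw [this]; exact ProbabilityTheory.integrable_gaussianPDFReal 0 1

theorem aux_pdf_integral : ∫ x, gaussPdf x = 1 := by
  have : gaussPdf = ProbabilityTheory.gaussianPDFReal 0 1 := funext aux_pdf_eq
  rw [this]; exact ProbabilityTheory.integral_gaussianPDFReal_eq_one 0 (by simp)

theorem aux_cdf_mono : Monotone gaussCdf := by
  intro a b hab
  unfold gaussCdf
  exact setIntegral_mono_set aux_pdf_int.integrableOn
    (Filter.Eventually.of_forall fun x => (aux_pdf_pos x).le)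
    (Set.Iic_subset_Iic.2 hab).eventuallyLE

theorem aux_cdf_surj {s : ℝ} (hs : s ∈ Set.Ioo (0:ℝ) 1) : ∃ x, gaussCdf x = s := by
  have hcont : Continuous gaussCdf := by
    have h1 : ∀ r, gaussCdf r = gaussCdf 0 + ∫ x in (0:ℝ)..r, gaussPdf x := by
      intro r
      rw [← intervalIntegral.integral_Iic_sub_Iic aux_pdf_int.integrableOn aux_pdf_int.integrableOn]
      unfold gaussCdf; ring
    rw [funext h1]
    exact continuous_const.add (intervalIntegral.continuous_primitive
      (fun a b => aux_pdf_int.intervalIntegrable) 0)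
  have h1 : Filter.Tendsto gaussCdf Filter.atTop (nhds 1) := by
    rw [← aux_pdf_integral]
    have := tendsto_setIntegral_of_monotone (μ := volume) (f := gaussPdf) (s := fun r : ℝ => Set.Iic r)
      (fun i => measurableSet_Iic) (fun a b h => Set.Iic_subset_Iic.2 h) aux_pdf_int.integrableOn
    rw [Set.iUnion_Iic, Measure.restrict_univ] at this
    exact this
  have h0 : Filter.Tendsto gaussCdf Filter.atBot (nhds 0) := by
    have h2 := tendsto_setIntegral_of_antitone (μ := volume) (f := gaussPdf)
      (s := fun r : ℝ => Set.Iic (-r))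
      (fun i => measurableSet_Iic) (fun a b h => Set.Iic_subset_Iic.2 (neg_le_neg h))
      ⟨0, aux_pdf_int.integrableOn⟩
    have he : (⋂ r : ℝ, Set.Iic (-r)) = ∅ := by
      ext x
      simp only [Set.mem_iInter, Set.mem_Iic, Set.mem_empty_iff_false, iff_false, not_forall]
      exact ⟨-x + 1, by linarith⟩
    rw [he, Measure.restrict_empty, integral_zero_measure] at h2
    have h3 := h2.comp Filter.tendsto_neg_atBot_atTop
    refine h3.congr fun x => ?_
    simp [gaussCdf]
  exact mem_range_of_exists_le_of_exists_ge hcont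
    ((h0.eventually_le_const hs.1).exists) ((h1.eventually_const_le hs.2).exists)

theorem aux_ratio_eq (x : ℝ) :
    gaussCdf x / gaussPdf x = ∫ u in Set.Ioi (0:ℝ), Real.exp (x * u - u ^ 2 / 2) := by
  have h1 : gaussCdf x = ∫ u in Set.Ioi (0:ℝ), gaussPdf (x - u) := by
    unfold gaussCdf
    rw [integral_Iic_eq_integral_Iio, ← integral_indicator measurableSet_Iio,
      ← integral_indicator measurableSet_Ioi,
      ← integral_sub_left_eq_self _ volume x]
    congr 1
    ext u
    by_cases hu : 0 < u
    · rw [Set.indicator_of_mem (by simpa using hu), Set.indicator_of_mem (by simpa using hu)]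
    · rw [Set.indicator_of_notMem (by simpa using hu), Set.indicator_of_notMem (by simpa using hu)]
  rw [h1, ← integral_div]
  congr 1
  ext u
  unfold gaussPdf
  rw [mul_div_mul_left _ _ (by positivity), ← Real.exp_sub]
  congr 1; ring

theorem aux_ratio_mono : Monotone fun x => gaussCdf x / gaussPdf x := by
  intro x y hxy
  simp only [aux_ratio_eq]
  have hint : ∀ x : ℝ, IntegrableOn (fun u => Real.exp (x * u - u ^ 2 / 2)) (Set.Ioi (0:ℝ)) := by
    intro x
    refine Integrable.integrableOn ?_
    have := (aux_pdf_int.comp_sub_left x).div_const (gaussPdf x)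
    refine this.congr (Filter.Eventually.of_forall fun u => ?_)
    simp only
    unfold gaussPdf
    rw [mul_div_mul_left _ _ (by positivity), ← Real.exp_sub]
    congr 1; ring
  refine setIntegral_mono_on (hint x) (hint y) measurableSet_Ioi fun u hu => ?_
  have : (0:ℝ) < u := hu
  gcongr

theorem aux_I_pos {s : ℝ} (hs : s ∈ Set.Ioo (0:ℝ) 1) : 0 < Igauss s := by
  unfold Igauss
  rw [if_neg (by rintro (h | h) <;> simp [h] at hs)]
  exact aux_pdf_pos _

theorem aux_I_ratio {s t : ℝ} (hs : s ∈ Set.Ioo (0:ℝ) 1) (ht : t ∈ Set.Ioo (0:ℝ) 1)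
    (hst : s ≤ t) : s / Igauss s ≤ t / Igauss t := by
  rcases hst.eq_or_lt with rfl | hlt
  · exact le_rfl
  have e1 : gaussCdf (gaussCdfInv s) = s := Function.invFun_eq (aux_cdf_surj hs)
  have e2 : gaussCdf (gaussCdfInv t) = t := Function.invFun_eq (aux_cdf_surj ht)
  have hle : gaussCdfInv s ≤ gaussCdfInv t := by
    by_contra h
    have := aux_cdf_mono (not_le.1 h).le
    rw [e1, e2] at this
    linarith
  have := aux_ratio_mono hle
  simp only [e1, e2] at this
  unfold Igauss
  rwa [if_neg (by rintro (h | h) <;> simp [h] at hs), if_neg (by rintro (h | h) <;> simp [h] at ht)]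

theorem aux_prob (n : ℕ) : IsProbabilityMeasure (gaussMeasure n) := by
  have := aux_isGaussian n
  infer_instance

theorem aux_dist_anti (n : ℕ) (g : (Fin n → ℝ) → ℝ) : Antitone (distFun n g) := by
  have := aux_prob n
  intro a b hab
  exact ENNReal.toReal_mono (by finiteness) (measure_mono fun x hx => lt_of_le_of_lt hab hx)

theorem aux_nonempty {n : ℕ} {g : (Fin n → ℝ) → ℝ} (hg : Measurable g) {s : ℝ} (hs : 0 < s) :
    {t : ℝ | 0 ≤ t ∧ distFun n g t ≤ s}.Nonempty := by
  have := aux_prob n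
  have h := tendsto_measure_iInter_atTop (μ := gaussMeasure n)
    (s := fun k : ℕ => {x | (k:ℝ) < |g x|})
    (fun k => (measurableSet_lt measurable_const (by fun_prop)).nullMeasurableSet)
    (fun a b hab x hx => by
      have h1 : (a:ℝ) ≤ b := Nat.cast_le.2 hab
      have h2 : (b:ℝ) < |g x| := hx
      exact h1.trans_lt h2) ⟨0, by finiteness⟩
  have he : (⋂ k : ℕ, {x | (k:ℝ) < |g x|}) = ∅ := by
    ext x
    simp only [Set.mem_iInter, Set.mem_ofPred_eq, Set.mem_empty_iff_false, iff_false, not_forall,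
      not_lt]
    exact exists_nat_ge _
  rw [he, measure_empty] at h
  have h2 := (ENNReal.tendsto_toReal ENNReal.zero_ne_top).comp h
  obtain ⟨k, hk⟩ := (h2.eventually_le_const (by simpa using hs)).exists
  exact ⟨k, Nat.cast_nonneg k, hk⟩

theorem aux_rearr_nonneg (n : ℕ) (g : (Fin n → ℝ) → ℝ) (s : ℝ) : 0 ≤ rearr n g s :=
  Real.sInf_nonneg fun _ hx => hx.1

theorem aux_rearr_le {n : ℕ} {g : (Fin n → ℝ) → ℝ} {s τ : ℝ} (h0 : 0 ≤ τ)
    (h : distFun n g τ ≤ s) : rearr n g s ≤ τ :=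
  csInf_le ⟨0, fun _ hx => hx.1⟩ ⟨h0, h⟩

theorem aux_lt_rearr {n : ℕ} {g : (Fin n → ℝ) → ℝ} (hg : Measurable g) {s τ : ℝ} (hs : 0 < s)
    (h : s < distFun n g τ) : τ < rearr n g s := by
  have := aux_prob n
  have h1 := tendsto_measure_iUnion_atTop (μ := gaussMeasure n)
    (s := fun k : ℕ => {x | τ + 1 / ((k:ℝ) + 1) < |g x|})
    (fun a b hab x hx => lt_of_le_of_lt (by
      have := Nat.one_div_le_one_div (α := ℝ) hab
      show τ + 1 / ((b:ℝ) + 1) ≤ τ + 1 / ((a:ℝ) + 1)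
      linarith) hx)
  have he : (⋃ k : ℕ, {x | τ + 1 / ((k:ℝ) + 1) < |g x|}) = {x | τ < |g x|} := by
    ext x
    simp only [Set.mem_iUnion, Set.mem_ofPred_eq]
    constructor
    · rintro ⟨k, hk⟩
      have : (0:ℝ) < 1 / ((k:ℝ) + 1) := by positivity
      linarith
    · intro hx
      obtain ⟨k, hk⟩ := exists_nat_one_div_lt (sub_pos.2 hx)
      exact ⟨k, by linarith⟩
  rw [he] at h1
  have h2 := (ENNReal.tendsto_toReal (by finiteness)).comp h1
  obtain ⟨k, hk⟩ := (h2.eventually_const_lt h).exists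
  have hpos : (0:ℝ) < 1 / ((k:ℝ) + 1) := by positivity
  have : τ + 1 / ((k:ℝ) + 1) ≤ rearr n g s := by
    refine le_csInf (aux_nonempty hg hs) fun r hr => ?_
    by_contra hlt
    have h3 := aux_dist_anti n g (not_le.1 hlt).le
    have h4 : s < distFun n g (τ + 1 / ((k:ℝ) + 1)) := hk
    linarith [hr.2]
  linarith

theorem aux_dist_rearr {n : ℕ} {g : (Fin n → ℝ) → ℝ} (hg : Measurable g) {s : ℝ} (hs : 0 < s) :
    distFun n g (rearr n g s) ≤ s := by
  by_contra h
  exact lt_irrefl _ (aux_lt_rearr hg hs (not_le.1 h))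

theorem aux_rearr_anti {n : ℕ} {g : (Fin n → ℝ) → ℝ} (hg : Measurable g) :
    AntitoneOn (rearr n g) (Set.Ioi 0) := fun _ ha _ _ hab =>
  csInf_le_csInf ⟨0, fun _ hx => hx.1⟩ (aux_nonempty hg ha) fun _ hx => ⟨hx.1, hx.2.trans hab⟩

theorem aux_le_compl {n : ℕ} {g : (Fin n → ℝ) → ℝ} (hg : Measurable g) (τ : ℝ) :
    (gaussMeasure n).real {x | |g x| ≤ τ} = 1 - distFun n g τ := by
  have := aux_prob n
  have h := probReal_compl_eq_one_sub (μ := gaussMeasure n) (s := {x | τ < |g x|})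
    (measurableSet_lt measurable_const (by fun_prop))
  have e : {x | τ < |g x|}ᶜ = {x | |g x| ≤ τ} := by ext; simp
  rw [e] at h
  exact h

theorem aux_le_meas {n : ℕ} {g : (Fin n → ℝ) → ℝ} (hg : Measurable g) {s : ℝ}
    (hs1 : s < 1) : s ≤ (gaussMeasure n).real {x | rearr n g s ≤ |g x|} := by
  have := aux_prob n
  set b := rearr n g s with hb
  have h1 := tendsto_measure_iUnion_atTop (μ := gaussMeasure n)
    (s := fun k : ℕ => {x | |g x| ≤ b - 1 / ((k:ℝ) + 1)})
    (fun i j hij x hx => le_trans hx (by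
      have := Nat.one_div_le_one_div (α := ℝ) hij
      show b - 1 / ((i:ℝ) + 1) ≤ b - 1 / ((j:ℝ) + 1)
      linarith))
  have he : (⋃ k : ℕ, {x | |g x| ≤ b - 1 / ((k:ℝ) + 1)}) = {x | b ≤ |g x|}ᶜ := by
    ext x
    simp only [Set.mem_iUnion, Set.mem_ofPred_eq, Set.mem_compl_iff, not_le]
    constructor
    · rintro ⟨k, hk⟩
      have : (0:ℝ) < 1 / ((k:ℝ) + 1) := by positivity
      linarith
    · intro hx
      obtain ⟨k, hk⟩ := exists_nat_one_div_lt (sub_pos.2 hx)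
      exact ⟨k, by linarith⟩
  rw [he] at h1
  have h2 := (ENNReal.tendsto_toReal (by finiteness)).comp h1
  have h3 : (gaussMeasure n).real {x | b ≤ |g x|}ᶜ ≤ 1 - s := by
    refine le_of_tendsto' h2 fun k => ?_
    have hpos : (0:ℝ) < 1 / ((k:ℝ) + 1) := by positivity
    show (gaussMeasure n).real {x | |g x| ≤ b - 1 / ((k:ℝ) + 1)} ≤ 1 - s
    by_cases h0 : 0 ≤ b - 1 / ((k:ℝ) + 1)
    · rw [aux_le_compl hg]
      by_contra hc
      have := aux_rearr_le (n := n) (g := g) (s := s) h0 (by linarith)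
      linarith
    · have : {x | |g x| ≤ b - 1 / ((k:ℝ) + 1)} = ∅ := by
        ext x
        simp only [Set.mem_ofPred_eq, Set.mem_empty_iff_false, iff_false, not_le]
        linarith [abs_nonneg (g x)]
      rw [this]; simp; linarith
  rw [probReal_compl_eq_one_sub (measurableSet_le measurable_const (by fun_prop))] at h3
  linarith

theorem aux_lip {n : ℕ} {f : (Fin n → ℝ) → ℝ} {K : NNReal} (hK : LipschitzWith K f) :
    ∃ C : ℝ, 0 ≤ C ∧ ∀ s s' : ℝ, 0 < s → s ≤ s' → s' < 1 →
      (rearr n f s - rearr n f s') * ((1 - s') * s) ≤ C * (s' - s) := by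
  have := aux_prob n
  have hf := hK.continuous.measurable
  have hK' : LipschitzWith K (fun x => |f x|) := by
    refine LipschitzWith.of_dist_le_mul fun x y => ?_
    refine le_trans ?_ (hK.dist_le_mul x y)
    rw [Real.dist_eq, Real.dist_eq]
    exact abs_abs_sub_abs_le_abs_sub _ _
  obtain ⟨C, hC, h⟩ := aux_iso hK'
  refine ⟨C, hC, fun s s' hs hss hs' => ?_⟩
  have hab := aux_rearr_anti hf hs (hs.trans_le hss) hss
  rcases hab.eq_or_lt with heq | hlt
  · rw [heq, sub_self, zero_mul]
    exact mul_nonneg hC (by linarith)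
  have h1 := h _ _ hab
  rw [aux_le_compl hf] at h1
  have h2 := aux_dist_rearr hf (hs.trans_le hss)
  have h3 := aux_le_meas (n := n) hf (s := s) (by linarith)
  have h4 : (gaussMeasure n).real {x | rearr n f s' < |f x| ∧ |f x| < rearr n f s} ≤ s' - s := by
    have e : {x | rearr n f s' < |f x| ∧ |f x| < rearr n f s} =
        {x | rearr n f s' < |f x|} \ {x | rearr n f s ≤ |f x|} := by
      ext x; simp
    have hsub : {x | rearr n f s ≤ |f x|} ⊆ {x | rearr n f s' < |f x|} := by
      intro x hx
      have h2 : rearr n f s ≤ |f x| := hx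
      exact hlt.trans_le h2
    rw [e, measureReal_sdiff hsub (measurableSet_le measurable_const (by fun_prop))]
    have h5 : (gaussMeasure n).real {x | rearr n f s' < |f x|} = distFun n f (rearr n f s') := rfl
    linarith
  calc _ ≤ (rearr n f s - rearr n f s') * ((1 - distFun n f (rearr n f s')) *
        (gaussMeasure n).real {x | rearr n f s ≤ |f x|}) := by
        refine mul_le_mul_of_nonneg_left ?_ (by linarith)
        exact mul_le_mul (by linarith) h3 hs.le (by linarith)
    _ ≤ _ := h1
    _ ≤ _ := by gcongr

theorem aux_HL {n : ℕ} {g : (Fin n → ℝ) → ℝ} (hg : Measurable g) {K : ℝ} (h0 : ∀ x, 0 ≤ g x)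
    (hgK : ∀ x, g x ≤ K) {E : Set (Fin n → ℝ)} {t : ℝ} (ht : 0 < t)
    (hE : (gaussMeasure n).real E ≤ t) :
    ∫ x in E, g x ∂(gaussMeasure n) ≤ ∫ s in (0:ℝ)..t, rearr n g s := by
  have := aux_prob n
  have hK0 : 0 ≤ K := (h0 0).trans (hgK 0)
  have hm : AEMeasurable (rearr n g) (volume.restrict (Set.Ioc 0 t)) :=
    aemeasurable_restrict_of_antitoneOn measurableSet_Ioc
      ((aux_rearr_anti hg).mono fun x hx => hx.1)
  have hb : ∀ s, 0 < s → rearr n g s ≤ K := fun s hs => aux_rearr_le hK0 (by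
    have : {x | K < |g x|} = ∅ := by
      ext x
      simp only [Set.mem_ofPred_eq, Set.mem_empty_iff_false, iff_false, not_lt]
      rw [abs_of_nonneg (h0 x)]; exact hgK x
    unfold distFun
    rw [this]; simpa using hs.le)
  have key : ∫⁻ x in E, ENNReal.ofReal (g x) ∂(gaussMeasure n) ≤
      ∫⁻ s in Set.Ioc 0 t, ENNReal.ofReal (rearr n g s) := by
    rw [lintegral_eq_lintegral_meas_lt _ (Filter.Eventually.of_forall h0) hg.aemeasurable,
      lintegral_eq_lintegral_meas_lt _
        (Filter.Eventually.of_forall fun s => aux_rearr_nonneg n g s) hm]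
    refine lintegral_mono fun τ => ?_
    have hmin : Set.Ioo 0 (min t (distFun n g τ)) ⊆ {s | τ < rearr n g s} ∩ Set.Ioc 0 t := by
      intro s hs
      have h1 := lt_min_iff.1 hs.2
      exact ⟨aux_lt_rearr hg hs.1 h1.2, hs.1, h1.1.le⟩
    calc (gaussMeasure n).restrict E {a | τ < g a}
        ≤ ENNReal.ofReal (min t (distFun n g τ)) := by
          rw [ENNReal.ofReal_min]
          refine le_min ?_ ?_
          · refine (measure_mono (Set.subset_univ _)).trans ?_
            rw [Measure.restrict_apply_univ]
            exact (ENNReal.le_ofReal_iff_toReal_le (by finiteness) ht.le).2 hE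
          · refine (Measure.restrict_apply_le _ _).trans ?_
            unfold distFun
            rw [ENNReal.ofReal_toReal (by finiteness)]
            exact measure_mono fun x hx => by
              have h2 : τ < g x := hx
              exact h2.trans_le (le_abs_self _)
      _ = volume (Set.Ioo 0 (min t (distFun n g τ))) := by simp
      _ ≤ volume ({s | τ < rearr n g s} ∩ Set.Ioc 0 t) := measure_mono hmin
      _ ≤ _ := Measure.le_restrict_apply _ _
  rw [intervalIntegral.integral_of_le ht.le,
    integral_eq_lintegral_of_nonneg_ae (Filter.Eventually.of_forall h0) hg.aestronglyMeasurable,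
    integral_eq_lintegral_of_nonneg_ae
      (Filter.Eventually.of_forall fun s => aux_rearr_nonneg n g s) hm.aestronglyMeasurable]
  refine ENNReal.toReal_mono ?_ key
  refine ne_top_of_le_ne_top ?_ (setLIntegral_mono' (g := fun _ => ENNReal.ofReal K)
    measurableSet_Ioc fun s hs => ENNReal.ofReal_le_ofReal (hb s hs.1))
  rw [setLIntegral_const]
  simp only [Real.volume_Ioc]
  finiteness

/-- The Gaussian Talenti inequality implies the oscillation inequality
`f**(t) - f*(t) ≤ (t/I(t)) |∇f|**(t)`. -/
theorem talenti_implies_oscillation (n : ℕ)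
    (htal : ∀ f : (Fin n → ℝ) → ℝ, (∃ K, LipschitzWith K f) →
      ∀ᵐ s ∂(volume.restrict (Set.Ioo (0:ℝ) 1)),
        deriv (fun u => - rearr n f u) s * Igauss s ≤
          deriv (fun u => ∫ x in {y | rearr n f u < |f y|},
            gradNorm n f x ∂gaussMeasure n) s) :
    ∀ f : (Fin n → ℝ) → ℝ, (∃ K, LipschitzWith K f) → ∀ t ∈ Set.Ioo (0:ℝ) 1,
      rearr2 n f t - rearr n f t ≤ t / Igauss t * rearr2 n (gradNorm n f) t := by
  rintro f ⟨K, hK⟩ t ht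
  have hp := aux_prob n
  have hf := hK.continuous.measurable
  set φ := rearr n f with hφ
  set g := gradNorm n f with hg
  have hg0 : ∀ x, 0 ≤ g x := fun x => norm_nonneg _
  have hgK : ∀ x, g x ≤ K := fun x => norm_fderiv_le_of_lipschitz ℝ hK
  have hgm : Measurable g := (measurable_fderiv ℝ f).norm
  have hgi : Integrable g (gaussMeasure n) :=
    Integrable.of_bound hgm.aestronglyMeasurable K (Filter.Eventually.of_forall fun x => by
      rw [Real.norm_of_nonneg (hg0 x)]; exact hgK x)
  set G : ℝ → ℝ := fun u => ∫ x in {y | φ u < |f y|}, g x ∂gaussMeasure n with hG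
  have hφa : AntitoneOn φ (Set.Ioi 0) := aux_rearr_anti hf
  have hφn : MonotoneOn (fun u => - φ u) (Set.Ioi 0) := hφa.neg
  have hφ0 : ∀ s, 0 ≤ φ s := aux_rearr_nonneg n f
  have hGm : MonotoneOn G (Set.Ioi 0) := by
    intro u hu v hv huv
    refine setIntegral_mono_set hgi.integrableOn (Filter.Eventually.of_forall hg0)
      (Filter.Eventually.of_forall fun x hx => ?_)
    have h1 : φ u < |f x| := hx
    exact (hφa hu hv huv).trans_lt h1
  have hG0 : ∀ u, 0 ≤ G u := fun u => integral_nonneg hg0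
  have hIt := aux_I_pos ht
  have hGt : G t ≤ ∫ s in (0:ℝ)..t, rearr n g s :=
    aux_HL hgm hg0 hgK ht.1 (aux_dist_rearr hf ht.1)
  have hc0 : 0 ≤ t / Igauss t := div_nonneg ht.1.le hIt.le
  have hder : ∀ (F : ℝ → ℝ), MonotoneOn F (Set.Ioi 0) → ∀ s, 0 < s → 0 ≤ deriv F s := by
    intro F hF s hs
    rw [← derivWithin_of_isOpen isOpen_Ioi (show s ∈ Set.Ioi 0 from hs)]
    exact hF.derivWithin_nonneg
  have main : ∀ ε ∈ Set.Ioo 0 t, ∫ s in ε..t, φ s ≤ t * φ t + t / Igauss t * G t := by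
    intro ε hε
    have hεt := hε.2.le
    have hac : AbsolutelyContinuousOnInterval (fun u => - φ u) ε t := by
      obtain ⟨C, hC, hL⟩ := aux_lip hK
      have hd : 0 < (1 - t) * ε := mul_pos (by linarith [ht.2]) hε.1
      have hmain : ∀ s s', ε ≤ s → s ≤ s' → s' ≤ t →
          φ s - φ s' ≤ C / ((1 - t) * ε) * (s' - s) := by
        intro s s' h1 h2 h3
        have h4 := hL s s' (hε.1.trans_le h1) h2 (h3.trans_lt ht.2)
        have h5 : 0 ≤ φ s - φ s' := sub_nonneg.2
          (hφa (hε.1.trans_le h1) (hε.1.trans_le (h1.trans h2)) h2)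
        have h6 : (1 - t) * ε ≤ (1 - s') * s :=
          mul_le_mul (by linarith) h1 hε.1.le (by linarith [ht.2])
        rw [div_mul_eq_mul_div, le_div_iff₀ hd]
        exact (mul_le_mul_of_nonneg_left h6 h5).trans h4
      refine LipschitzOnWith.absolutelyContinuousOnInterval
        (K := ⟨C / ((1 - t) * ε), div_nonneg hC hd.le⟩) ?_
      rw [Set.uIcc_of_le hεt]
      refine LipschitzOnWith.of_dist_le_mul fun x hx y hy => ?_
      show dist (-φ x) (-φ y) ≤ C / ((1 - t) * ε) * dist x y
      rw [dist_neg_neg]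
      rcases le_total x y with hxy | hxy
      · have := hmain x y hx.1 hxy hy.2
        have h5 := hφa (hε.1.trans_le hx.1) (hε.1.trans_le hy.1) hxy
        rw [Real.dist_eq, dist_comm, Real.dist_eq, abs_of_nonneg (by linarith),
          abs_of_nonneg (by linarith)]
        exact this
      · have := hmain y x hy.1 hxy hx.2
        have h5 := hφa (hε.1.trans_le hy.1) (hε.1.trans_le hx.1) hxy
        rw [dist_comm, Real.dist_eq, Real.dist_eq, abs_of_nonneg (by linarith),
          abs_of_nonneg (by linarith)]
        exact this
    have hid : AbsolutelyContinuousOnInterval (fun u : ℝ => u) ε t :=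
      (LipschitzWith.id.lipschitzOnWith (s := Set.uIcc ε t)).absolutelyContinuousOnInterval
    have hibp := hid.integral_mul_deriv_eq_deriv_mul hac
    simp only [deriv_id'', one_mul, intervalIntegral.integral_neg] at hibp
    have hsub : Set.uIcc ε t ⊆ Set.Ioi 0 := by
      rw [Set.uIcc_of_le hεt]
      exact fun x hx => hε.1.trans_le hx.1
    have hGi := (hGm.mono hsub).intervalIntegrable_deriv
    have hGle := (hGm.mono hsub).intervalIntegral_deriv_mem_uIcc
    rw [Set.uIcc_of_le (sub_nonneg.2 (hGm hε.1 ht.1 hεt))] at hGle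
    have hcmp : ∫ s in ε..t, s * deriv (fun u => - φ u) s ≤
        ∫ s in ε..t, t / Igauss t * deriv G s := by
      refine intervalIntegral.integral_mono_ae_restrict hεt
        (hac.intervalIntegrable_deriv.continuousOn_mul continuousOn_id)
        (hGi.const_mul _) ?_
      have h1 := ae_restrict_of_ae_restrict_of_subset (s := Set.Icc ε t)
        (t := Set.Ioo (0:ℝ) 1) (fun x hx => ⟨hε.1.trans_le hx.1, hx.2.trans_lt ht.2⟩) (htal f ⟨K, hK⟩)
      filter_upwards [h1, ae_restrict_mem measurableSet_Icc] with s hs hsm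
      have hs0 : 0 < s := hε.1.trans_le hsm.1
      have hs01 : s ∈ Set.Ioo (0:ℝ) 1 := ⟨hs0, hsm.2.trans_lt ht.2⟩
      have hIs := aux_I_pos hs01
      have hr := aux_I_ratio hs01 ht hsm.2
      calc s * deriv (fun u => - φ u) s
          = s / Igauss s * (deriv (fun u => - φ u) s * Igauss s) := by field_simp
        _ ≤ s / Igauss s * deriv G s :=
            mul_le_mul_of_nonneg_left hs (div_nonneg hs0.le hIs.le)
        _ ≤ t / Igauss t * deriv G s := mul_le_mul_of_nonneg_right hr (hder G hGm s hs0)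
    rw [hibp, intervalIntegral.integral_const_mul] at hcmp
    have h3 : t / Igauss t * ∫ s in ε..t, deriv G s ≤ t / Igauss t * G t :=
      mul_le_mul_of_nonneg_left (by linarith [hGle.2, hG0 ε]) hc0
    have h4 : 0 ≤ ε * φ ε := mul_nonneg hε.1.le (hφ0 ε)
    linarith
  have fin : ∫ s in (0:ℝ)..t, φ s ≤ t * φ t + t / Igauss t * G t := by
    by_cases hi : IntervalIntegrable φ volume 0 t
    · have hcont := intervalIntegral.continuousOn_primitive_interval_left
        (show IntegrableOn φ (Set.uIcc 0 t) by
          rw [Set.uIcc_of_le ht.1.le]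
          exact (intervalIntegrable_iff_integrableOn_Icc_of_le ht.1.le).1 hi)
      have h0 := (hcont 0 Set.left_mem_uIcc).mono
        (show Set.Ioo 0 t ⊆ Set.uIcc 0 t by
          rw [Set.uIcc_of_le ht.1.le]; exact Set.Ioo_subset_Icc_self)
      have hne : (nhdsWithin (0:ℝ) (Set.Ioo 0 t)).NeBot := by
        rw [nhdsWithin_Ioo_eq_nhdsGT ht.1]; infer_instance
      exact le_of_tendsto h0 (by
        filter_upwards [self_mem_nhdsWithin] with ε hε using main ε hε)
    · rw [intervalIntegral.integral_undef hi]
      exact add_nonneg (mul_nonneg ht.1.le (hφ0 t)) (mul_nonneg hc0 (hG0 t))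
  unfold rearr2
  have hfin2 : ∫ s in (0:ℝ)..t, φ s ≤
      t * φ t + t / Igauss t * ∫ s in (0:ℝ)..t, rearr n g s :=
    fin.trans (by gcongr)
  have ht0 := ht.1
  calc 1 / t * (∫ s in (0:ℝ)..t, φ s) - φ t
      ≤ 1 / t * (t * φ t + t / Igauss t * ∫ s in (0:ℝ)..t, rearr n g s) - φ t := by gcongr
    _ = _ := by field_simp; ring
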